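/- arXiv:math/0511074 — 10 statements merged into one kernel-verified Lean document; each statement's English description precedes it below -/
import Mathlib

section
/- For every real number s > 1, every nonnegative integer n, and every positive integer k, the tail of the Dirichlet series for the Riemann zeta function satisfies the Euler–Maclaurin identity: ∑_{ν=n+1}^{∞} (ν+1)^{-s} = (n+2)^{1-s}/(s-1) + (1/2)(n+2)^{-s} + ∑_{j=1}^{k} [(s)_{2j-1} B_{2j}/(2j)!] (n+2)^{-s-2j+1} − [(s)_{2k}/(2k)!] ∫_{n+1}^{∞} B_{2k}(x − ⌊x⌋)/(x+1)^{s+2k} dx, where the integral on the right-hand side converges. -/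
open MeasureTheory Polynomial Finset

/-- The periodized Bernoulli polynomial: `B_m (x - ⌊x⌋)`. -/
noncomputable def bernoulliPeriodic (m : ℕ) (x : ℝ) : ℝ :=
  ((Polynomial.bernoulli m).map (algebraMap ℚ ℝ)).eval (Int.fract x)

open Filter Topology intervalIntegral

theorem bernoulliPeriodic_eq (m : ℕ) (x : ℝ) :
    bernoulliPeriodic m x = bernoulliFun m (Int.fract x) := rfl

theorem measurable_bernoulliPeriodic (m : ℕ) : Measurable (bernoulliPeriodic m) :=
  (continuous_bernoulliFun m).measurable.comp measurable_fract

theorem exists_norm_bernoulliPeriodic_le (m : ℕ) : ∃ C, ∀ x, ‖bernoulliPeriodic m x‖ ≤ C := by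
  obtain ⟨C, hC⟩ := (isCompact_Icc (a := (0 : ℝ)) (b := 1)).exists_bound_of_continuousOn
    (continuous_bernoulliFun m).continuousOn
  exact ⟨C, fun x => hC _ ⟨Int.fract_nonneg x, (Int.fract_lt_one x).le⟩⟩

theorem integrableOn_bernoulliPeriodic_div_rpow (m : ℕ) {r a : ℝ} (hr : 1 < r) (ha : -1 < a) :
    IntegrableOn (fun x : ℝ => bernoulliPeriodic m x / (x + 1) ^ r) (Set.Ioi a) := by
  obtain ⟨C, hC⟩ := exists_norm_bernoulliPeriodic_le m
  have h : IntegrableOn (fun x : ℝ => bernoulliPeriodic m x * (x + 1) ^ (-r)) (Set.Ioi a) :=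
    (integrableOn_add_rpow_Ioi_of_lt (by linarith) (by linarith)).bdd_mul
      (measurable_bernoulliPeriodic m).aestronglyMeasurable (ae_of_all _ hC)
  refine h.congr_fun (fun x hx => ?_) measurableSet_Ioi
  have hx' : a < x := hx
  simp only [Real.rpow_neg (show 0 ≤ x + 1 by linarith), div_eq_mul_inv]

/-- On a unit interval with integer endpoints the periodized Bernoulli polynomial is a translate of
the Bernoulli polynomial on `[0, 1]`. -/
theorem integral_unit_bernoulliPeriodic_div_rpow (m p : ℕ) (r : ℝ) :
    ∫ x in (p : ℝ)..p + 1, bernoulliPeriodic m x / (x + 1) ^ r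
      = ∫ t in (0 : ℝ)..1, bernoulliFun m t * (p + 1 + t) ^ (-r) := by
  have h := integral_comp_add_left (a := 0) (b := 1)
    (fun x : ℝ => bernoulliPeriodic m x / (x + 1) ^ r) (p : ℝ)
  rw [add_zero] at h
  rw [← h]
  refine integral_congr_Ioo_of_le zero_le_one fun t ht => ?_
  have hp : (0 : ℝ) ≤ p := p.cast_nonneg
  have hfract : Int.fract ((p : ℝ) + t) = t := by
    rw [Int.fract_natCast_add, Int.fract_eq_self.2 ⟨ht.1.le, ht.2⟩]
  simp only [bernoulliPeriodic_eq, hfract]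
  rw [Real.rpow_neg (by linarith [ht.1]), div_eq_mul_inv, add_right_comm]

/-- Integration by parts for `B_m` against a power on `[0, 1]`. -/
theorem integral_bernoulliFun_mul_rpow (m : ℕ) (r : ℝ) {c : ℝ} (hc : 0 < c) :
    ∫ t in (0 : ℝ)..1, bernoulliFun m t * (c + t) ^ (-r)
      = (bernoulliFun (m + 1) 1 * (c + 1) ^ (-r) - bernoulliFun (m + 1) 0 * c ^ (-r)) / (m + 1)
        + r / (m + 1) * ∫ t in (0 : ℝ)..1, bernoulliFun (m + 1) t * (c + t) ^ (-(r + 1)) := by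
  have hpos : ∀ t ∈ Set.uIcc (0 : ℝ) 1, 0 < c + t := fun t ht => by
    rw [Set.uIcc_of_le zero_le_one] at ht
    linarith [ht.1]
  have hderiv : ∀ t ∈ Set.uIcc (0 : ℝ) 1,
      HasDerivAt (fun t : ℝ => (c + t) ^ (-r)) (-r * (c + t) ^ (-(r + 1))) t := fun t ht => by
    convert! ((hasDerivAt_id t).const_add c).rpow_const (p := -r) (Or.inl (hpos t ht).ne') using 1
    simp only [id, one_mul]
    congr 2
    ring
  have hcont : ContinuousOn (fun t : ℝ => -r * (c + t) ^ (-(r + 1))) (Set.uIcc 0 1) :=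
    continuousOn_const.mul ((continuousOn_const.add continuousOn_id).rpow_const
      fun t ht => Or.inl (hpos t ht).ne')
  have h := integral_mul_deriv_eq_deriv_mul hderiv (fun t _ => antideriv_bernoulliFun m t)
    hcont.intervalIntegrable (intervalIntegrable_bernoulliFun m 0 1)
  have hrem : ∫ t in (0 : ℝ)..1, -r * (c + t) ^ (-(r + 1)) * (bernoulliFun (m + 1) t / (m + 1))
      = -(r / (m + 1)) * ∫ t in (0 : ℝ)..1, bernoulliFun (m + 1) t * (c + t) ^ (-(r + 1)) := by
    rw [← intervalIntegral.integral_const_mul]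
    congr 1 with t
    ring
  rw [hrem, add_zero] at h
  simp only [mul_comm (bernoulliFun m _)]
  rw [h]
  ring

theorem tendsto_sum_integral_bernoulliPeriodic (m p : ℕ) {r : ℝ} (hr : 1 < r) :
    Tendsto (fun M : ℕ => ∑ ν ∈ range M,
        ∫ t in (0 : ℝ)..1, bernoulliFun m t * ((p : ℝ) + ν + 1 + t) ^ (-r)) atTop
      (𝓝 (∫ x in Set.Ioi (p : ℝ), bernoulliPeriodic m x / (x + 1) ^ r)) := by
  have hp : (0 : ℝ) ≤ p := p.cast_nonneg
  have hint := integrableOn_bernoulliPeriodic_div_rpow m hr (show (-1 : ℝ) < p by linarith)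
  refine (intervalIntegral_tendsto_integral_Ioi (p : ℝ) hint
    (tendsto_atTop_add_const_left atTop (p : ℝ) tendsto_natCast_atTop_atTop)).congr fun M => ?_
  have h := sum_integral_adjacent_intervals (a := fun ν : ℕ => (p : ℝ) + ν) (n := M) (μ := volume)
    (f := fun x : ℝ => bernoulliPeriodic m x / (x + 1) ^ r) fun ν _ => by
      rw [intervalIntegrable_iff_integrableOn_Ioc_of_le (by push_cast; linarith)]
      exact hint.mono_set fun x hx => lt_of_le_of_lt (by simp) hx.1
  simp only [Nat.cast_zero, add_zero] at h
  rw [← h]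
  refine sum_congr rfl fun ν _ => ?_
  have hunit := integral_unit_bernoulliPeriodic_div_rpow m (p + ν) r
  push_cast at hunit ⊢
  rw [← add_assoc, hunit]

theorem summable_add_natCast_rpow_neg {c s : ℝ} (hc : 0 ≤ c) (hs : 1 < s) :
    Summable fun ν : ℕ => (c + ν) ^ (-s) := by
  refine ((Real.summable_one_div_nat_add_rpow c s).2 hs).congr fun ν => ?_
  have h : (0 : ℝ) ≤ c + ν := by positivity
  rw [add_comm, abs_of_nonneg h, Real.rpow_neg h, one_div]

theorem tendsto_add_natCast_rpow_neg (c : ℝ) {r : ℝ} (hr : 0 < r) :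
    Tendsto (fun M : ℕ => (c + M) ^ (-r)) atTop (𝓝 0) :=
  (tendsto_rpow_neg_atTop hr).comp
    (tendsto_atTop_add_const_left atTop c tendsto_natCast_atTop_atTop)

/-- The Euler–Maclaurin step for `m ≥ 1`. -/
theorem integral_bernoulliPeriodic_succ {m : ℕ} (hm : m ≠ 0) (p : ℕ) {r : ℝ} (hr : 1 < r) :
    ∫ x in Set.Ioi (p : ℝ), bernoulliPeriodic m x / (x + 1) ^ r
      = -((_root_.bernoulli (m + 1) : ℝ) / (m + 1) * ((p : ℝ) + 1) ^ (-r))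
        + r / (m + 1)
          * ∫ x in Set.Ioi (p : ℝ), bernoulliPeriodic (m + 1) x / (x + 1) ^ (r + 1) := by
  refine tendsto_nhds_unique (tendsto_sum_integral_bernoulliPeriodic m p hr) ?_
  have h := ((((tendsto_add_natCast_rpow_neg ((p : ℝ) + 1) (by linarith : 0 < r)).sub_const
    (((p : ℝ) + 1) ^ (-r))).const_mul ((_root_.bernoulli (m + 1) : ℝ) / (m + 1))).add
    ((tendsto_sum_integral_bernoulliPeriodic (m + 1) p (by linarith : 1 < r + 1)).const_mul
      (r / (m + 1))))
  rw [zero_sub, mul_neg] at h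
  refine h.congr fun M => ?_
  have htel := sum_range_sub (fun ν : ℕ => ((p : ℝ) + 1 + ν) ^ (-r)) M
  simp only [Nat.cast_zero, add_zero] at htel
  rw [← htel, mul_sum, mul_sum, ← sum_add_distrib]
  refine sum_congr rfl fun ν _ => ?_
  rw [integral_bernoulliFun_mul_rpow m r (by positivity : (0 : ℝ) < p + ν + 1),
    bernoulliFun_endpoints_eq_of_ne_one (by omega), bernoulliFun_eval_zero]
  push_cast
  rw [show (p : ℝ) + 1 + (ν + 1) = p + ν + 1 + 1 by ring,
    show (p : ℝ) + 1 + ν = p + ν + 1 by ring]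
  ring

theorem integral_Ioi_bernoulliPeriodic_zero (p : ℕ) {s : ℝ} (hs : 1 < s) :
    ∫ x in Set.Ioi (p : ℝ), bernoulliPeriodic 0 x / (x + 1) ^ s
      = ((p : ℝ) + 1) ^ (1 - s) / (s - 1) := by
  have hp : (0 : ℝ) ≤ p := p.cast_nonneg
  have hint := integrableOn_bernoulliPeriodic_div_rpow 0 hs (show (-1 : ℝ) < p by linarith)
  have hpow := intervalIntegral_tendsto_integral_Ioi ((p : ℝ) + 1)
    (integrableOn_Ioi_rpow_of_lt (a := -s) (by linarith) (by linarith : (0 : ℝ) < p + 1))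
    (tendsto_atTop_add_const_right atTop (1 : ℝ) tendsto_id)
  rw [integral_Ioi_rpow_of_lt (by linarith) (by linarith)] at hpow
  have hval : -((p : ℝ) + 1) ^ (-s + 1) / (-s + 1) = ((p : ℝ) + 1) ^ (1 - s) / (s - 1) := by
    rw [show -s + 1 = 1 - s by ring, ← neg_sub s 1, div_neg, neg_div, neg_neg]
  rw [hval] at hpow
  refine tendsto_nhds_unique (intervalIntegral_tendsto_integral_Ioi (p : ℝ) hint tendsto_id)
    (hpow.congr' ?_)
  filter_upwards [eventually_ge_atTop (p : ℝ)] with b hb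
  rw [id, ← integral_comp_add_right (fun x : ℝ => x ^ (-s))]
  refine integral_congr_Ioo_of_le hb fun x hx => ?_
  simp only [bernoulliPeriodic_eq, bernoulliFun_zero]
  rw [Real.rpow_neg (by linarith [hx.1]), one_div]

/-- The first Euler–Maclaurin step, with remainder involving `B_1`. -/
theorem tsum_rpow_neg_eq_bernoulliPeriodic_one (p : ℕ) {s : ℝ} (hs : 1 < s) :
    ∑' ν : ℕ, ((p : ℝ) + 1 + ν) ^ (-s)
      = ((p : ℝ) + 1) ^ (1 - s) / (s - 1) + 1 / 2 * ((p : ℝ) + 1) ^ (-s)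
        - s * ∫ x in Set.Ioi (p : ℝ), bernoulliPeriodic 1 x / (x + 1) ^ (s + 1) := by
  have hsum := summable_add_natCast_rpow_neg (by positivity : (0 : ℝ) ≤ p + 1) hs
  have hlim := tendsto_sum_integral_bernoulliPeriodic 0 p hs
  rw [integral_Ioi_bernoulliPeriodic_zero p hs] at hlim
  have h := (hsum.hasSum.tendsto_sum_nat.add
    (((tendsto_add_natCast_rpow_neg ((p : ℝ) + 1) (by linarith : 0 < s)).sub_const
      (((p : ℝ) + 1) ^ (-s))).const_mul (1 / 2))).add
    ((tendsto_sum_integral_bernoulliPeriodic 1 p (by linarith : 1 < s + 1)).const_mul s)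
  have heq := tendsto_nhds_unique hlim (h.congr fun M => ?_)
  · linarith
  have htel := sum_range_sub (fun ν : ℕ => ((p : ℝ) + 1 + ν) ^ (-s)) M
  simp only [Nat.cast_zero, add_zero] at htel
  rw [← htel, mul_sum, mul_sum, ← sum_add_distrib, ← sum_add_distrib]
  refine sum_congr rfl fun ν _ => ?_
  rw [integral_bernoulliFun_mul_rpow 0 s (by positivity : (0 : ℝ) < p + ν + 1), zero_add]
  have h0 : bernoulliFun 1 0 = -(1 / 2) := by rw [bernoulliFun_one]; norm_num
  have h1 : bernoulliFun 1 1 = 1 / 2 := by rw [bernoulliFun_one]; norm_num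
  rw [h0, h1]
  push_cast
  rw [show (p : ℝ) + 1 + (ν + 1) = p + ν + 1 + 1 by ring,
    show (p : ℝ) + 1 + ν = p + ν + 1 by ring]
  ring

/-- `integral_bernoulliPeriodic_succ` with the Pochhammer normalization of the remainders. -/
theorem ascPochhammer_mul_integral_succ {m : ℕ} (hm : m ≠ 0) (p : ℕ) {s : ℝ} (hs : 1 < s) :
    (ascPochhammer ℝ m).eval s / m.factorial
        * ∫ x in Set.Ioi (p : ℝ), bernoulliPeriodic m x / (x + 1) ^ (s + m)
      = -((ascPochhammer ℝ m).eval s * (_root_.bernoulli (m + 1) : ℝ) / (m + 1).factorial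
          * ((p : ℝ) + 1) ^ (-(s + m)))
        + (ascPochhammer ℝ (m + 1)).eval s / (m + 1).factorial
          * ∫ x in Set.Ioi (p : ℝ),
              bernoulliPeriodic (m + 1) x / (x + 1) ^ (s + (m + 1 : ℕ)) := by
  have hm0 : (0 : ℝ) ≤ m := m.cast_nonneg
  have hfac : (m.factorial : ℝ) ≠ 0 := by positivity
  have hm1 : (m : ℝ) + 1 ≠ 0 := by positivity
  rw [integral_bernoulliPeriodic_succ hm p (by linarith : 1 < s + m), ascPochhammer_succ_eval,
    Nat.factorial_succ]
  push_cast
  rw [← add_assoc s]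
  field_simp

/-- The Euler–Maclaurin formula with remainder of odd index. -/
theorem tsum_rpow_neg_eq_bernoulliPeriodic_odd (p k : ℕ) {s : ℝ} (hs : 1 < s) :
    ∑' ν : ℕ, ((p : ℝ) + 1 + ν) ^ (-s)
      = ((p : ℝ) + 1) ^ (1 - s) / (s - 1) + 1 / 2 * ((p : ℝ) + 1) ^ (-s)
        + ∑ j ∈ Icc 1 k, (ascPochhammer ℝ (2 * j - 1)).eval s * (bernoulli (2 * j) : ℝ)
            / (2 * j).factorial * ((p : ℝ) + 1) ^ (-s - 2 * (j : ℝ) + 1)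
        - (ascPochhammer ℝ (2 * k + 1)).eval s / (2 * k + 1).factorial
          * ∫ x in Set.Ioi (p : ℝ),
              bernoulliPeriodic (2 * k + 1) x / (x + 1) ^ (s + (2 * k + 1 : ℕ)) := by
  induction k with
  | zero => simpa using tsum_rpow_neg_eq_bernoulliPeriodic_one p hs
  | succ k ih =>
    have hodd := ascPochhammer_mul_integral_succ (m := 2 * k + 1) (by omega) p hs
    have heven := ascPochhammer_mul_integral_succ (m := 2 * k + 2) (by omega) p hs
    rw [bernoulli_eq_zero_of_odd (n := 2 * k + 2 + 1) ⟨k + 1, by ring⟩ (by omega)] at heven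
    rw [ih, sum_Icc_succ_top (by omega), hodd]
    have hexp : -s - 2 * ((k + 1 : ℕ) : ℝ) + 1 = -(s + (2 * k + 1 : ℕ)) := by push_cast; ring
    rw [hexp, show 2 * (k + 1) - 1 = 2 * k + 1 by omega, show 2 * (k + 1) = 2 * k + 2 by ring]
    simp only [Rat.cast_zero, mul_zero, zero_div, zero_mul, neg_zero, zero_add] at heven
    rw [← heven]
    ring

theorem euler_maclaurin_zeta_tail (s : ℝ) (hs : 1 < s) (n : ℕ) (k : ℕ) (hk : 0 < k) :
    IntegrableOn
      (fun x : ℝ => bernoulliPeriodic (2 * k) x / (x + 1) ^ (s + 2 * k))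
      (Set.Ioi ((n : ℝ) + 1)) ∧
    ∑' ν : ℕ, ((n : ℝ) + 2 + ν) ^ (-s)
      = ((n : ℝ) + 2) ^ (1 - s) / (s - 1) + (1 / 2) * ((n : ℝ) + 2) ^ (-s)
        + ∑ j ∈ Finset.Icc 1 k,
            ((ascPochhammer ℝ (2 * j - 1)).eval s * (bernoulli (2 * j) : ℝ)
                / (Nat.factorial (2 * j)))
              * ((n : ℝ) + 2) ^ (-s - 2 * (j : ℝ) + 1)
        - ((ascPochhammer ℝ (2 * k)).eval s / (Nat.factorial (2 * k)))
            * ∫ x in Set.Ioi ((n : ℝ) + 1),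
                bernoulliPeriodic (2 * k) x / (x + 1) ^ (s + 2 * k) := by
  have hn : (0 : ℝ) ≤ n := n.cast_nonneg
  have hk0 : (0 : ℝ) ≤ k := k.cast_nonneg
  refine ⟨integrableOn_bernoulliPeriodic_div_rpow _ (by linarith) (by linarith), ?_⟩
  have h := tsum_rpow_neg_eq_bernoulliPeriodic_odd (n + 1) k hs
  have heven := ascPochhammer_mul_integral_succ (m := 2 * k) (by omega) (n + 1) hs
  rw [bernoulli_eq_zero_of_odd (n := 2 * k + 1) ⟨k, rfl⟩ (by omega)] at heven
  simp only [Rat.cast_zero, mul_zero, zero_div, zero_mul, neg_zero, zero_add] at heven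
  rw [← heven] at h
  have hcast : ((n + 1 : ℕ) : ℝ) + 1 = n + 2 := by push_cast; ring
  rw [hcast] at h
  simpa only [Nat.cast_add, Nat.cast_mul, Nat.cast_one, Nat.cast_ofNat] using h
end

section
/- Let s be a complex number with s ≠ 1, let (β_μ)_{μ≥0} be any sequence of complex numbers, and define γ_0 = β_0/(s−1) and γ_μ = (−1)^μ (s)_{μ−1} β_μ/μ! for μ ≥ 1. Then for every nonnegative integer μ one has the identity ∑_{λ=0}^{μ} (1−s−μ)_{λ+1} γ_{μ−λ}/(λ+1)! = [(−1)^{μ+1} (s)_{μ}/(μ+1)!] ∑_{σ=0}^{μ} C(μ+1, σ) β_σ, where C(μ+1, σ) is the binomial coefficient. -/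
open Polynomial Finset

/-- Reflection formula `(-r)_k = (-1)^k (r - k + 1)_k`. -/
theorem ascPochhammer_eval_neg_eq_ascPochhammer {R : Type*} [CommRing R] (r : R) (k : ℕ) :
    (ascPochhammer R k).eval (-r) = (-1) ^ k * (ascPochhammer R k).eval (r - k + 1) := by
  rw [ascPochhammer_eval_neg_eq_descPochhammer, descPochhammer_eval_eq_ascPochhammer]

/-- Splitting a rising factorial: `(s)_m (s + m)_n = (s)_{m+n}`. -/
theorem ascPochhammer_eval_mul_eval_add {R : Type*} [CommRing R] (s : R) (m n : ℕ) :
    (ascPochhammer R m).eval s * (ascPochhammer R n).eval (s + m)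
      = (ascPochhammer R (m + n)).eval s := by
  rw [← ascPochhammer_mul]
  simp

theorem zeta_linear_system_reduction (s : ℂ) (hs : s ≠ 1) (β γ : ℕ → ℂ)
    (hγ0 : γ 0 = β 0 / (s - 1))
    (hγ : ∀ μ : ℕ, 1 ≤ μ →
      γ μ = (-1 : ℂ) ^ μ * (ascPochhammer ℂ (μ - 1)).eval s * β μ / (Nat.factorial μ)) :
    ∀ μ : ℕ,
      ∑ lam ∈ Finset.range (μ + 1),
          (ascPochhammer ℂ (lam + 1)).eval (1 - s - (μ : ℂ)) * γ (μ - lam)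
            / (Nat.factorial (lam + 1))
        = (-1 : ℂ) ^ (μ + 1) * (ascPochhammer ℂ μ).eval s / (Nat.factorial (μ + 1))
            * ∑ σ ∈ Finset.range (μ + 1), (Nat.choose (μ + 1) σ : ℂ) * β σ := by
  have hsplit : ∀ σ k : ℕ, (ascPochhammer ℂ (k + 1)).eval (s + σ - 1) * γ σ
      = (-1 : ℂ) ^ σ * (ascPochhammer ℂ (σ + k)).eval s * β σ / (Nat.factorial σ) := by
    rintro (_ | σ) k
    · have hs' : s - 1 ≠ 0 := sub_ne_zero.mpr hs
      have h := ascPochhammer_eval_mul_eval_add (s - 1) 1 k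
      simp only [ascPochhammer_one, eval_X, Nat.cast_one, sub_add_cancel, add_comm 1 k] at h
      simp only [Nat.cast_zero, add_zero, zero_add, ← h, hγ0]
      field_simp
      simp
    · have h := ascPochhammer_eval_mul_eval_add s σ (k + 1)
      rw [hγ _ (by omega), show s + ((σ + 1 : ℕ) : ℂ) - 1 = s + σ by push_cast; ring,
        show σ + 1 + k = σ + (k + 1) by omega, ← h, Nat.add_sub_cancel]
      ring
  intro μ
  rw [← Finset.sum_range_reflect, Finset.mul_sum]
  refine Finset.sum_congr rfl fun σ hσ => ?_
  obtain ⟨k, rfl⟩ := Nat.exists_eq_add_of_le (Nat.lt_succ_iff.mp (Finset.mem_range.mp hσ))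
  rw [show σ + k + 1 - 1 - σ = k by omega, show σ + k - k = σ by omega,
    show 1 - s - ((σ + k : ℕ) : ℂ) = -(s + σ + k - 1) by push_cast; ring,
    ascPochhammer_eval_neg_eq_ascPochhammer,
    show s + σ + k - 1 - ((k + 1 : ℕ) : ℂ) + 1 = s + σ - 1 by push_cast; ring,
    mul_assoc, hsplit, Nat.cast_choose ℂ (by omega : σ ≤ σ + k + 1),
    show σ + k + 1 - σ = k + 1 by omega]
  have h₁ : ((σ + k + 1).factorial : ℂ) ≠ 0 := Nat.cast_ne_zero.mpr (Nat.factorial_ne_zero _)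
  have h₂ : ((k + 1).factorial : ℂ) ≠ 0 := Nat.cast_ne_zero.mpr (Nat.factorial_ne_zero _)
  have h₃ : (σ.factorial : ℂ) ≠ 0 := Nat.cast_ne_zero.mpr (Nat.factorial_ne_zero _)
  field_simp
  ring
end

section
/- Let s be a complex number with s ≠ 1 and let m be a positive integer. Define, for each nonnegative integer n, T_n = (n+2)^{1−s} [ 1/(s−1) + ∑_{μ=1}^{m} (−1)^μ (s)_{μ−1} B_μ/μ! · (n+2)^{−μ} ], where B_μ is the μ-th Bernoulli number. Then the sequence (n+2)^{s} (T_n − T_{n+1}) − 1 is O(n^{−m−1}) as n → ∞; that is, the truncated Bernoulli-number expansion solves the difference equation Δ(−T_n) = (n+2)^{−s} up to a relative error of order n^{−m−1}. -/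
open Polynomial Finset Filter Asymptotics

/-- Taylor expansion of `(1 + h) ^ a` at `h = 0`, with remainder. -/
theorem one_add_cpow_sub_sum_choose_isBigO (a : ℂ) (N : ℕ) :
    (fun h : ℂ => (1 + h) ^ a - ∑ j ∈ range N, Ring.choose a j * h ^ j)
      =O[nhds 0] fun h => h ^ N := by
  have key := (Complex.one_add_cpow_hasFPowerSeriesAt_zero (a := a)).isBigO_sub_partialSum_pow N
  simp only [zero_add, FormalMultilinearSeries.partialSum, binomialSeries_apply,
    List.ofFn_const, List.prod_replicate, smul_eq_mul, ← norm_pow] at key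
  exact key.of_norm_right

/-- The recursion of the Bernoulli numbers, weighted by generalized binomial coefficients. -/
theorem sum_bernoulli_mul_choose_mul_choose (r : ℂ) (p : ℕ) :
    ∑ k ∈ range p, (bernoulli k : ℂ) * Ring.choose r k * Ring.choose (r - k) (p - k)
      = if p = 1 then r else 0 := by
  have hb : ∑ k ∈ range p, (p.choose k : ℂ) * (bernoulli k : ℂ) = if p = 1 then 1 else 0 := by
    have := congrArg (Rat.cast : ℚ → ℂ) (sum_bernoulli p)
    rw [Rat.cast_sum] at this
    simpa [apply_ite (Rat.cast : ℚ → ℂ)] using this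
  calc _ = ∑ k ∈ range p, Ring.choose r p * ((p.choose k : ℂ) * (bernoulli k : ℂ)) := by
        refine sum_congr rfl fun k hk => ?_
        rw [mul_assoc, ← Ring.choose_smul_choose r (mem_range.1 hk).le, nsmul_eq_mul]
        ring
    _ = _ := by
        rw [← mul_sum, hb]
        split_ifs with hp
        · simp [hp]
        · simp

/-- The polynomial part of the expansion telescopes to its linear term. -/
theorem sum_bernoulli_mul_choose_mul_truncated_binomial (r h : ℂ) (m : ℕ) :
    ∑ k ∈ range (m + 1), (bernoulli k : ℂ) * Ring.choose r k * h ^ k *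
        (∑ j ∈ range (m + 2 - k), Ring.choose (r - k) j * h ^ j - 1) = r * h := by
  let f : ℕ → ℕ → ℂ := fun k j =>
    if j = 0 then 0 else (bernoulli k : ℂ) * Ring.choose r k * h ^ k * (Ring.choose (r - k) j * h ^ j)
  have hf : ∀ k ∈ range (m + 1), (bernoulli k : ℂ) * Ring.choose r k * h ^ k *
      (∑ j ∈ range (m + 2 - k), Ring.choose (r - k) j * h ^ j - 1)
        = ∑ j ∈ range (m + 2 - k), f k j := by
    intro k hk
    obtain ⟨d, hd⟩ : ∃ d, m + 2 - k = d + 1 := ⟨m + 1 - k, by grind⟩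
    rw [hd, sum_range_succ', sum_range_succ']
    simp [f, mul_sum]
  have hdiag : ∀ p ∈ range (m + 2), ∑ k ∈ range (p + 1), f k (p - k)
      = if p = 1 then r * h else 0 := by
    intro p _
    rw [sum_range_succ]
    calc _ = ∑ k ∈ range p, h ^ p *
          ((bernoulli k : ℂ) * Ring.choose r k * Ring.choose (r - k) (p - k)) := by
          simp only [Nat.sub_self, f, if_true, add_zero]
          refine sum_congr rfl fun k hk => ?_
          have hk := mem_range.1 hk
          rw [if_neg (by omega), ← Nat.add_sub_cancel' hk.le, pow_add]
          simp only [Nat.add_sub_cancel_left]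
          ring
      _ = _ := by
          rw [← mul_sum, sum_bernoulli_mul_choose_mul_choose]
          split_ifs with hp
          · rw [hp]; ring
          · simp
  have hlast : ∑ j ∈ range (m + 2 - (m + 1)), f (m + 1) j = 0 := by
    simp [show m + 2 - (m + 1) = 1 by omega, f]
  rw [sum_congr rfl hf]
  have := sum_range_diag_flip (m + 2) f
  rw [sum_congr rfl hdiag, sum_range_succ (fun k => ∑ j ∈ range (m + 2 - k), f k j) (m + 1),
    hlast, add_zero] at this
  rw [← this]
  simp

/-- The difference equation in the variable `h = 1 / x` near `h = 0`. -/
theorem sum_bernoulli_mul_choose_mul_one_add_cpow_isBigO (r : ℂ) (m : ℕ) :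
    (fun h : ℂ => ∑ k ∈ range (m + 1), (bernoulli k : ℂ) * Ring.choose r k * h ^ k *
        ((1 + h) ^ (r - k) - 1) - r * h) =O[nhds 0] fun h => h ^ (m + 2) := by
  have hsum : (fun h : ℂ => ∑ k ∈ range (m + 1), (bernoulli k : ℂ) * Ring.choose r k * h ^ k *
      ((1 + h) ^ (r - k) - ∑ j ∈ range (m + 2 - k), Ring.choose (r - k) j * h ^ j))
        =O[nhds 0] fun h => h ^ (m + 2) := by
    refine IsBigO.fun_sum fun k hk => ?_
    have hk : k ≤ m + 2 := by grind
    have := ((isBigO_refl (fun h : ℂ => h ^ k) (nhds 0)).const_mul_left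
      ((bernoulli k : ℂ) * Ring.choose r k)).mul
        (one_add_cpow_sub_sum_choose_isBigO (r - k) (m + 2 - k))
    simpa only [← pow_add, Nat.add_sub_cancel' hk] using this
  refine hsum.congr_left fun h => ?_
  rw [← sum_bernoulli_mul_choose_mul_truncated_binomial r h m, ← sum_sub_distrib]
  exact sum_congr rfl fun k _ => by ring

theorem choose_neg_eq_ascPochhammer (a : ℂ) (k : ℕ) :
    Ring.choose (-a) k = (-1) ^ k * (ascPochhammer ℂ k).eval a / k.factorial := by
  have hfac : (k.factorial : ℂ) ≠ 0 := Nat.cast_ne_zero.2 k.factorial_ne_zero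
  have hmulti := Ring.factorial_nsmul_multichoose_eq_ascPochhammer a k
  rw [ascPochhammer_smeval_eq_eval, nsmul_eq_mul] at hmulti
  rw [Ring.choose_neg', ← hmulti, Units.smul_def, zsmul_eq_mul, Int.cast_negOnePow_natCast]
  field_simp

/-- The coefficients of the expansion as generalized binomial coefficients. -/
theorem bernoulli_mul_choose_eq_ascPochhammer (s : ℂ) (k : ℕ) :
    (bernoulli (k + 1) : ℂ) * Ring.choose (1 - s) (k + 1) = (s - 1) *
      ((-1) ^ (k + 1) * (ascPochhammer ℂ k).eval s * (bernoulli (k + 1) : ℂ)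
        / (Nat.factorial (k + 1))) := by
  rw [← neg_sub, choose_neg_eq_ascPochhammer, ascPochhammer_succ_left]
  simp
  ring

theorem bracket_eq_sum_choose (s : ℂ) (hs : s ≠ 1) (m : ℕ) (x : ℂ) :
    1 / (s - 1) + ∑ μ ∈ Finset.Icc 1 m,
      (-1 : ℂ) ^ μ * (ascPochhammer ℂ (μ - 1)).eval s * (bernoulli μ : ℂ)
        / (Nat.factorial μ) * x ^ (-(μ : ℂ))
      = (s - 1)⁻¹ * ∑ k ∈ range (m + 1),
        (bernoulli k : ℂ) * Ring.choose (1 - s) k * x ^ (-(k : ℂ)) := by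
  have hs' : s - 1 ≠ 0 := sub_ne_zero.2 hs
  rw [sum_range_succ', ← Finset.Ico_add_one_right_eq_Icc, sum_Ico_eq_sum_range, mul_add, mul_sum,
    add_comm]
  congr 1
  · refine sum_congr rfl fun k _ => ?_
    rw [bernoulli_mul_choose_eq_ascPochhammer, add_comm 1 k, Nat.add_sub_cancel]
    field_simp
  · simp

theorem zeta_truncated_expansion_solves_difference_equation
    (s : ℂ) (hs : s ≠ 1) (m : ℕ) (hm : 1 ≤ m) :
    (fun n : ℕ =>
        ((n : ℂ) + 2) ^ s *
            ((((n : ℂ) + 2) ^ (1 - s) *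
                (1 / (s - 1) + ∑ μ ∈ Finset.Icc 1 m,
                  (-1 : ℂ) ^ μ * (ascPochhammer ℂ (μ - 1)).eval s * (bernoulli μ : ℂ)
                      / (Nat.factorial μ) * ((n : ℂ) + 2) ^ (-(μ : ℂ))))
              - (((n : ℂ) + 3) ^ (1 - s) *
                  (1 / (s - 1) + ∑ μ ∈ Finset.Icc 1 m,
                    (-1 : ℂ) ^ μ * (ascPochhammer ℂ (μ - 1)).eval s * (bernoulli μ : ℂ)
                        / (Nat.factorial μ) * ((n : ℂ) + 3) ^ (-(μ : ℂ)))))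
          - 1)
      =O[atTop] fun n : ℕ => (n : ℝ) ^ (-(m : ℝ) - 1) := by
  have hs' : s - 1 ≠ 0 := sub_ne_zero.2 hs
  have hlim : Tendsto (fun n : ℕ => ((n : ℂ) + 2)⁻¹) atTop (nhds 0) := by
    have := (tendsto_inv_atTop_nhds_zero_nat (𝕜 := ℂ)).comp (tendsto_add_atTop_nat 2)
    simpa [Function.comp_def] using this
  have hO := ((isBigO_refl (fun n : ℕ => (n : ℂ) + 2) atTop).const_mul_left (-(s - 1)⁻¹)).mul
    ((sum_bernoulli_mul_choose_mul_one_add_cpow_isBigO (1 - s) m).comp_tendsto hlim)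
  refine (hO.congr_left fun n => ?_).trans ?_
  · have hx : (n : ℂ) + 2 ≠ 0 := by exact_mod_cast (by omega : n + 2 ≠ 0)
    have hy : (n : ℂ) + 3 ≠ 0 := by exact_mod_cast (by omega : n + 3 ≠ 0)
    have hshift : ∀ a : ℂ, ((n : ℂ) + 3) ^ a
        = ((n : ℂ) + 2) ^ a * (1 + ((n : ℂ) + 2)⁻¹) ^ a := by
      intro a
      have h := Complex.mul_cpow_ofReal_nonneg (a := (n : ℝ) + 2) (b := 1 + ((n : ℝ) + 2)⁻¹)
        (by positivity) (by positivity) a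
      push_cast at h
      rw [← h]
      congr 1
      field_simp
      ring
    have hxs : ((n : ℂ) + 2) ^ s * ((n : ℂ) + 2) ^ (1 - s) = (n : ℂ) + 2 := by
      rw [← Complex.cpow_add _ _ hx]
      simp
    have hmul : ((n : ℂ) + 3) ^ (1 - s) * ∑ k ∈ range (m + 1),
        (bernoulli k : ℂ) * Ring.choose (1 - s) k * ((n : ℂ) + 3) ^ (-(k : ℂ))
        = ((n : ℂ) + 2) ^ (1 - s) * ∑ k ∈ range (m + 1), (bernoulli k : ℂ) *
          Ring.choose (1 - s) k * ((n : ℂ) + 2)⁻¹ ^ k * (1 + ((n : ℂ) + 2)⁻¹) ^ (1 - s - k) := by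
      rw [mul_sum, mul_sum]
      refine sum_congr rfl fun k _ => ?_
      have h3 : ((n : ℂ) + 3) ^ (1 - s) * ((n : ℂ) + 3) ^ (-(k : ℂ)) = ((n : ℂ) + 2) ^ (1 - s) *
          (((n : ℂ) + 2)⁻¹ ^ k * (1 + ((n : ℂ) + 2)⁻¹) ^ (1 - s - k)) := by
        rw [← Complex.cpow_add _ _ hy, ← sub_eq_add_neg, hshift, Complex.cpow_sub _ _ hx,
          Complex.cpow_natCast, inv_pow]
        ring
      linear_combination (bernoulli k : ℂ) * Ring.choose (1 - s) k * h3
    have hone : ∑ k ∈ range (m + 1),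
        (bernoulli k : ℂ) * Ring.choose (1 - s) k * ((n : ℂ) + 2) ^ (-(k : ℂ))
        = ∑ k ∈ range (m + 1),
          (bernoulli k : ℂ) * Ring.choose (1 - s) k * ((n : ℂ) + 2)⁻¹ ^ k := by
      simp only [Complex.cpow_neg, Complex.cpow_natCast, inv_pow]
    rw [bracket_eq_sum_choose s hs, bracket_eq_sum_choose s hs, mul_left_comm (((n : ℂ) + 3) ^ _),
      hmul, hone]
    simp only [Function.comp_apply, mul_sub, mul_one, sum_sub_distrib]
    set A := ∑ k ∈ range (m + 1),
          (bernoulli k : ℂ) * Ring.choose (1 - s) k * ((n : ℂ) + 2)⁻¹ ^ k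
    set B := ∑ k ∈ range (m + 1), (bernoulli k : ℂ) *
          Ring.choose (1 - s) k * ((n : ℂ) + 2)⁻¹ ^ k * (1 + ((n : ℂ) + 2)⁻¹) ^ (1 - s - k)
    have hinv : ((n : ℂ) + 2) * ((n : ℂ) + 2)⁻¹ = 1 := mul_inv_cancel₀ hx
    have hsinv : (s - 1)⁻¹ * (s - 1) = 1 := inv_mul_cancel₀ hs'
    linear_combination (-(s - 1)⁻¹ * (A - B)) * hxs - hinv * ((s - 1)⁻¹ * (s - 1)) - hsinv
  · refine IsBigO.of_bound 1 ?_
    filter_upwards [eventually_gt_atTop 0] with n hn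
    have hn' : (0 : ℝ) < n := by exact_mod_cast hn
    have hnorm : ‖(n : ℂ) + 2‖ = (n : ℝ) + 2 := by
      have := Complex.norm_natCast (n + 2)
      push_cast at this
      exact this
    have hpow : (n : ℝ) ^ (-(m : ℝ) - 1) = ((n : ℝ) ^ (m + 1))⁻¹ := by
      rw [← neg_add', Real.rpow_neg hn'.le, ← Nat.cast_add_one, Real.rpow_natCast]
    have hx : (n : ℝ) + 2 ≠ 0 := by positivity
    simp only [Function.comp_apply, norm_mul, norm_pow, norm_inv, hnorm, hpow, one_mul]
    rw [Real.norm_of_nonneg hn'.le, pow_succ' _ (m + 1), mul_inv_cancel_left₀ hx, inv_pow]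
    gcongr
    linarith
end

section
/- Let a, b, c, z be complex numbers with 0 < |z| < 1 and with none of a, b, c a nonpositive integer. Then the ratio of the tail of the Gaussian hypergeometric series to its first neglected term converges: lim_{n→∞} [∑_{ν=n+1}^{∞} (a)_ν (b)_ν z^ν/((c)_ν ν!)] / [(a)_{n+1} (b)_{n+1} z^{n+1}/((c)_{n+1} (n+1)!)] = 1/(1−z). -/
open Polynomial Filter

/-- If consecutive quotients of a nowhere vanishing sequence tend to `z`, then quotients of terms
at distance `k` tend to `z ^ k`. -/
theorem tendsto_add_div_of_tendsto_succ_div {𝕜 : Type*} [NormedField 𝕜] {u : ℕ → 𝕜} {z : 𝕜}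
    (hu : ∀ n, u n ≠ 0) (h : Tendsto (fun n => u (n + 1) / u n) atTop (nhds z)) (k : ℕ) :
    Tendsto (fun n => u (n + k) / u n) atTop (nhds (z ^ k)) := by
  induction k with
  | zero => simp [hu]
  | succ k ih =>
    rw [pow_succ']
    refine ((h.comp (tendsto_add_atTop_nat k)).mul ih).congr fun n => ?_
    exact div_mul_div_cancel₀ (hu (n + k))

/-- If consecutive quotients of a nowhere vanishing sequence tend to `z` with `‖z‖ < 1`, then the
quotient of the tail of the series by its first term tends to `(1 - z)⁻¹`. -/
theorem tendsto_tsum_tail_div_of_tendsto_succ_div {𝕜 : Type*} [NormedField 𝕜] [CompleteSpace 𝕜]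
    {u : ℕ → 𝕜} {z : 𝕜} (hu : ∀ n, u n ≠ 0) (hz : ‖z‖ < 1)
    (h : Tendsto (fun n => u (n + 1) / u n) atTop (nhds z)) :
    Tendsto (fun n => (∑' k, u (n + k)) / u n) atTop (nhds (1 - z)⁻¹) := by
  obtain ⟨r, hzr, hr⟩ := exists_between hz
  have hr0 : 0 ≤ r := (norm_nonneg z).trans hzr.le
  obtain ⟨N, hN⟩ := eventually_atTop.1 (h.norm.eventually_le_const hzr)
  rw [← tsum_geometric_of_norm_lt_one hz]
  simp only [← tsum_div_const]
  refine tendsto_tsum_of_dominated_convergence (summable_geometric_of_lt_one hr0 hr)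
    (tendsto_add_div_of_tendsto_succ_div hu h) ?_
  filter_upwards [eventually_ge_atTop N] with n hn k
  induction k with
  | zero => simp [hu]
  | succ k ih =>
    rw [← add_assoc, ← div_mul_div_cancel₀ (hu (n + k)), norm_mul, pow_succ']
    exact mul_le_mul (hN _ (by omega)) ih (norm_nonneg _) hr0

theorem ascPochhammer_eval_ne_zero {𝕜 : Type*} [Field 𝕜] {a : 𝕜} (ha : ∀ k : ℕ, a ≠ -(k : 𝕜))
    (n : ℕ) : (ascPochhammer 𝕜 n).eval a ≠ 0 := by
  induction n with
  | zero => simp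
  | succ n ih =>
    rw [ascPochhammer_succ_eval]
    exact mul_ne_zero ih fun h => ha n (eq_neg_of_add_eq_zero_left h)

theorem gauss_hypergeometric_tail_ratio_limit (a b c z : ℂ)
    (hz0 : 0 < ‖z‖) (hz1 : ‖z‖ < 1)
    (ha : ∀ k : ℕ, a ≠ -(k : ℂ)) (hb : ∀ k : ℕ, b ≠ -(k : ℂ)) (hc : ∀ k : ℕ, c ≠ -(k : ℂ)) :
    Tendsto
      (fun n : ℕ =>
        (∑' ν : ℕ,
            (ascPochhammer ℂ (n + 1 + ν)).eval a * (ascPochhammer ℂ (n + 1 + ν)).eval b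
              * z ^ (n + 1 + ν)
              / ((ascPochhammer ℂ (n + 1 + ν)).eval c * (Nat.factorial (n + 1 + ν))))
          / ((ascPochhammer ℂ (n + 1)).eval a * (ascPochhammer ℂ (n + 1)).eval b * z ^ (n + 1)
              / ((ascPochhammer ℂ (n + 1)).eval c * (Nat.factorial (n + 1)))))
      atTop (nhds (1 / (1 - z))) := by
  have hz : z ≠ 0 := norm_pos_iff.1 hz0
  let u : ℕ → ℂ := fun n => (ascPochhammer ℂ n).eval a * (ascPochhammer ℂ n).eval b * z ^ n
    / ((ascPochhammer ℂ n).eval c * (Nat.factorial n))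
  have hu : ∀ n, u n ≠ 0 := fun n =>
    div_ne_zero
      (mul_ne_zero (mul_ne_zero (ascPochhammer_eval_ne_zero ha n) (ascPochhammer_eval_ne_zero hb n))
        (pow_ne_zero n hz))
      (mul_ne_zero (ascPochhammer_eval_ne_zero hc n) (Nat.cast_ne_zero.2 n.factorial_ne_zero))
  have hratio : Tendsto (fun n => u (n + 1) / u n) atTop (nhds z) := by
    have hac := tendsto_add_mul_div_add_mul_atTop_nhds a c (1 : ℂ) one_ne_zero
    have hb1 := tendsto_add_mul_div_add_mul_atTop_nhds b 1 (1 : ℂ) one_ne_zero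
    have hlim := (hac.mul hb1).mul_const z
    simp only [div_one, one_mul] at hlim
    refine hlim.congr fun n => ?_
    have hA := ascPochhammer_eval_ne_zero ha n
    have hB := ascPochhammer_eval_ne_zero hb n
    have hC := ascPochhammer_eval_ne_zero hc n
    have hcn : c + n ≠ 0 := fun h => hc n (eq_neg_of_add_eq_zero_left h)
    have hn : (1 + n : ℂ) ≠ 0 := by rw [add_comm]; exact n.cast_add_one_ne_zero
    have hf : (n.factorial : ℂ) ≠ 0 := Nat.cast_ne_zero.2 n.factorial_ne_zero
    simp only [u, ascPochhammer_succ_eval, Nat.factorial_succ, Nat.cast_mul, Nat.cast_succ,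
      add_comm (n : ℂ) 1, pow_succ]
    field_simp
  rw [one_div]
  exact (tendsto_tsum_tail_div_of_tendsto_succ_div hu hz1 hratio).comp (tendsto_add_atTop_nat 1)
end

section
/- Let a, b, c, z be complex numbers with z ≠ 1, and set γ_0 = 1/(1−z) and γ_1 = z(a+b−c−1)/(1−z)^2. Then, as n → ∞, γ_0 + γ_1/(n+1) − [(a+n+1)(b+n+1) z / ((c+n+1)(n+2))] · (γ_0 + γ_1/(n+2)) − 1 = O(n^{−2}). -/
open Filter Asymptotics

/-- The reciprocal of a shifted natural number is `O(1 / n)`. -/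
theorem isBigO_inv_const_add_natCast (d : ℂ) :
    (fun n : ℕ => (d + (n : ℂ))⁻¹) =O[atTop] fun n : ℕ => (n : ℝ)⁻¹ := by
  have hd : (fun _ : ℕ => d) =o[atTop] fun n : ℕ => (n : ℂ) := by
    refine isLittleO_const_left.2 (Or.inr ?_)
    simpa [Function.comp_def] using tendsto_natCast_atTop_atTop (R := ℝ)
  have h : (fun n : ℕ => (n : ℂ)) =O[atTop] fun n : ℕ => d + (n : ℂ) :=
    hd.right_isBigO_add
  have hinv : (fun n : ℕ => (d + (n : ℂ))⁻¹) =O[atTop] fun n : ℕ => (n : ℂ)⁻¹ := by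
    refine h.inv_rev ?_
    filter_upwards [eventually_ne_atTop 0] with n hn hn'
    exact absurd (Nat.cast_eq_zero.1 hn') hn
  exact hinv.trans (IsBigO.of_norm_le fun n => by simp)

/-- The residual is a sum of products, each with at least two reciprocals of shifts of `n`. -/
theorem gauss_hypergeometric_residual_eq (a b c z : ℂ) (hz : z ≠ 1) (x : ℂ)
    (h₁ : x + 1 ≠ 0) (h₂ : x + 2 ≠ 0) (hc : c + x + 1 ≠ 0)
    (γ0 γ1 : ℂ) (h0 : γ0 = 1 / (1 - z)) (h1 : γ1 = z * (a + b - c - 1) / (1 - z) ^ 2) :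
    γ0 + γ1 / (x + 1)
        - (a + x + 1) * (b + x + 1) * z / ((c + x + 1) * (x + 2)) * (γ0 + γ1 / (x + 2)) - 1
      = γ1 * ((1 + x)⁻¹ * (2 + x)⁻¹)
        - z * (a + b - c - 1) * γ1 * ((2 + x)⁻¹ * (2 + x)⁻¹)
        - z * ((a - c) * (b - c))
          * ((c + 1 + x)⁻¹ * (2 + x)⁻¹) * (γ0 + γ1 * (2 + x)⁻¹) := by
  have hz' : 1 - z ≠ 0 := sub_ne_zero.2 hz.symm
  have e0 : γ0 * (1 - z) = 1 := by rw [h0]; field_simp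
  have e1 : γ1 * (1 - z) = z * (a + b - c - 1) * γ0 := by rw [h0, h1]; field_simp
  have ratio : (a + x + 1) * (b + x + 1) * z / ((c + x + 1) * (x + 2))
      = z * (1 + (a + b - c - 1) * (x + 2)⁻¹
        + (a - c) * (b - c) * ((c + x + 1)⁻¹ * (x + 2)⁻¹)) := by
    field_simp
    ring
  have diff : (x + 1)⁻¹ = (x + 2)⁻¹ + (x + 1)⁻¹ * (x + 2)⁻¹ := by
    field_simp
    ring
  rw [ratio, add_comm 1 x, add_comm 2 x, add_right_comm c 1 x, div_eq_mul_inv, div_eq_mul_inv]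
  linear_combination γ1 * diff + e0 + (x + 2)⁻¹ * e1

theorem gauss_hypergeometric_order_one_solution (a b c z : ℂ) (hz : z ≠ 1)
    (γ0 γ1 : ℂ) (h0 : γ0 = 1 / (1 - z)) (h1 : γ1 = z * (a + b - c - 1) / (1 - z) ^ 2) :
    (fun n : ℕ =>
        γ0 + γ1 / ((n : ℂ) + 1)
          - (a + (n : ℂ) + 1) * (b + (n : ℂ) + 1) * z / ((c + (n : ℂ) + 1) * ((n : ℂ) + 2))
              * (γ0 + γ1 / ((n : ℂ) + 2))
          - 1)
      =O[atTop] fun n : ℕ => (n : ℝ) ^ (-2 : ℝ) := by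
  have hpow : (fun n : ℕ => (n : ℝ) ^ (-2 : ℝ)) = fun n : ℕ => (n : ℝ)⁻¹ * (n : ℝ)⁻¹ := by
    funext n
    rw [Real.rpow_neg n.cast_nonneg, Real.rpow_two, sq, mul_inv]
  have hc : ∀ᶠ n : ℕ in atTop, c + (n : ℂ) + 1 ≠ 0 := by
    filter_upwards [eventually_gt_atTop ⌈‖c + 1‖⌉₊] with n hn h
    have hn' : ‖c + 1‖ < n := Nat.lt_of_ceil_lt hn
    have hcn : c + 1 = -(n : ℂ) := by linear_combination h
    simp [hcn] at hn'
  have hbdd : (fun n : ℕ => γ0 + γ1 * (2 + (n : ℂ))⁻¹) =O[atTop] fun _ : ℕ => (1 : ℝ) := by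
    refine (isBigO_const_const γ0 one_ne_zero _).add (IsBigO.const_mul_left ?_ γ1)
    exact (isBigO_inv_const_add_natCast 2).trans
      ((tendsto_inv_atTop_nhds_zero_nat (𝕜 := ℝ)).isBigO_one ℝ)
  have hprod (d e : ℂ) : (fun n : ℕ => (d + (n : ℂ))⁻¹ * (e + (n : ℂ))⁻¹) =O[atTop]
      fun n : ℕ => (n : ℝ)⁻¹ * (n : ℝ)⁻¹ :=
    (isBigO_inv_const_add_natCast d).mul (isBigO_inv_const_add_natCast e)
  rw [hpow]
  have hlast := ((hprod (c + 1) 2).const_mul_left (z * ((a - c) * (b - c)))).mul hbdd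
  simp only [mul_one] at hlast
  refine IsBigO.congr' ((((hprod 1 2).const_mul_left γ1).sub
    ((hprod 2 2).const_mul_left (z * (a + b - c - 1) * γ1))).sub hlast) ?_ EventuallyEq.rfl
  filter_upwards [hc] with n hn
  exact (gauss_hypergeometric_residual_eq a b c z hz n (by exact_mod_cast n.succ_ne_zero)
    (by exact_mod_cast (n + 1).succ_ne_zero) hn γ0 γ1 h0 h1).symm
end

section
/- Let a, b, c, z be complex numbers with z ≠ 1, and define γ_0 = 1/(1−z), γ_1 = z(a+b−c−1)/(1−z)^2, γ_2 = z{[a² + (b−c−2)a + b² − (c+2)b + 1 + 2c]z + (b−c−1)a − (c+1)b + 1 + c + c²}/(1−z)^3, and γ_3 = z{[a³ + (b−c−3)a² + (b² − (c+3)b + 3 + 3c)a + b³ − (c+3)b² + (3+3c)b − 1 − 3c]z² + [(2b−2c−3)a² + (2b² − (4c+8)b + 2c² + 7 + 8c)a − (2c+3)b² + (2c² + 7 + 8c)b − 4 − 5c² − 7c]z + [−(c+1)b + 1 + c² + c]a + (1 + c² + c)b − 1 − c² − c − c³}/(1−z)^4. Then, as n → ∞, ∑_{μ=0}^{3} γ_μ/(n+1)^μ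 − [(a+n+1)(b+n+1) z / ((c+n+1)(n+2))] · ∑_{μ=0}^{3} γ_μ/(n+2)^μ − 1 = O(n^{−4}). -/
open Filter Asymptotics

/-- The terms of order at least four, divided by `x ^ 4`, of the polynomial obtained from the
order-three ansatz at `x = 1 / (n + 1)` by clearing the denominator `(1 + c * x) * (1 + x) ^ 4`. -/
def ansatzRemainder (a b c z γ0 γ1 γ2 γ3 x : ℂ) : ℂ :=
  ((γ0 - 1) * (1 + 4 * c) + γ1 * (4 + 6 * c) + γ2 * (6 + 4 * c) + γ3 * (4 + c)
      - z * ((a + b) * (γ0 + γ1 + γ2 + γ3) + a * b * (3 * γ0 + 2 * γ1 + γ2)))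
    + ((γ0 - 1) * c + γ1 * (1 + 4 * c) + γ2 * (4 + 6 * c) + γ3 * (6 + 4 * c)
      - z * (a * b * (γ0 + γ1 + γ2 + γ3))) * x
    + (γ1 * c + γ2 * (1 + 4 * c) + γ3 * (4 + 6 * c)) * x ^ 2
    + (γ2 * c + γ3 * (1 + 4 * c)) * x ^ 3 + γ3 * c * x ^ 4

/-- If the coefficients of order at most three vanish, the ansatz is `O(n⁻⁴)`. -/
theorem ansatz_isBigO (a b c z γ0 γ1 γ2 γ3 : ℂ)
    (e0 : γ0 - 1 - z * γ0 = 0)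
    (e1 : (γ0 - 1) * (4 + c) + γ1 - z * (3 * γ0 + γ1 + (a + b) * γ0) = 0)
    (e2 : (γ0 - 1) * (6 + 4 * c) + γ1 * (4 + c) + γ2
      - z * (3 * γ0 + 2 * γ1 + γ2 + (a + b) * (3 * γ0 + γ1) + a * b * γ0) = 0)
    (e3 : (γ0 - 1) * (4 + 6 * c) + γ1 * (6 + 4 * c) + γ2 * (4 + c) + γ3
      - z * (γ0 + γ1 + γ2 + γ3 + (a + b) * (3 * γ0 + 2 * γ1 + γ2)
        + a * b * (3 * γ0 + γ1)) = 0) :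
    (fun n : ℕ =>
        (γ0 + γ1 / ((n : ℂ) + 1) + γ2 / ((n : ℂ) + 1) ^ 2 + γ3 / ((n : ℂ) + 1) ^ 3)
          - (a + (n : ℂ) + 1) * (b + (n : ℂ) + 1) * z / ((c + (n : ℂ) + 1) * ((n : ℂ) + 2))
              * (γ0 + γ1 / ((n : ℂ) + 2) + γ2 / ((n : ℂ) + 2) ^ 2 + γ3 / ((n : ℂ) + 2) ^ 3)
          - 1)
      =O[atTop] fun n : ℕ => (n : ℝ) ^ (-4 : ℝ) := by
  have hx : Tendsto (fun n : ℕ => 1 / ((n : ℂ) + 1)) atTop (nhds 0) :=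
    tendsto_one_div_add_atTop_nhds_zero_nat
  have hden : Tendsto (fun n : ℕ => (1 + c * (1 / ((n : ℂ) + 1))) * (1 + 1 / ((n : ℂ) + 1)) ^ 4)
      atTop (nhds 1) := by
    simpa using ((hx.const_mul c).const_add 1).mul ((hx.const_add 1).pow 4)
  have hnum : Tendsto (fun n : ℕ => ansatzRemainder a b c z γ0 γ1 γ2 γ3 (1 / ((n : ℂ) + 1)))
      atTop (nhds (ansatzRemainder a b c z γ0 γ1 γ2 γ3 0)) := by
    have hcont : Continuous (ansatzRemainder a b c z γ0 γ1 γ2 γ3) := by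
      unfold ansatzRemainder
      fun_prop
    exact (hcont.tendsto 0).comp hx
  have hquot := (hnum.div hden one_ne_zero).isBigO_one ℝ
  have hpow : (fun n : ℕ => (1 / ((n : ℂ) + 1)) ^ 4) =O[atTop]
      fun n : ℕ => (n : ℝ) ^ (-4 : ℝ) := by
    refine IsBigO.of_bound 1 ?_
    filter_upwards [eventually_gt_atTop 0] with n hn
    have hn' : (0 : ℝ) < n := by exact_mod_cast hn
    have hnorm : ‖(n : ℂ) + 1‖ = (n : ℝ) + 1 := by
      rw [← Nat.cast_add_one, Complex.norm_natCast, Nat.cast_add_one]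
    rw [Real.rpow_neg hn'.le, show (4 : ℝ) = ((4 : ℕ) : ℝ) by norm_num, Real.rpow_natCast,
      norm_pow, norm_div, hnorm, norm_one, one_mul, norm_inv, norm_pow, Real.norm_of_nonneg hn'.le,
      ← inv_pow, one_div]
    gcongr
    linarith
  have hprod := hpow.mul hquot
  simp only [mul_one] at hprod
  refine hprod.congr' ?_ EventuallyEq.rfl
  filter_upwards [hden.eventually_ne one_ne_zero] with n hn
  have hn1 : (n : ℂ) + 1 ≠ 0 := Nat.cast_add_one_ne_zero n
  obtain ⟨x, hxn⟩ : ∃ x : ℂ, x = 1 / ((n : ℂ) + 1) := ⟨_, rfl⟩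
  have hx0 : x ≠ 0 := by
    rw [hxn]
    exact one_div_ne_zero hn1
  have hnx : (n : ℂ) = 1 / x - 1 := by
    rw [hxn, one_div_one_div]
    ring
  simp only [Pi.div_apply]
  rw [← hxn] at hn ⊢
  have hcx : 1 + x * c ≠ 0 := mul_comm c x ▸ left_ne_zero_of_mul hn
  have hx1 : 1 + x ≠ 0 := fun h => hn (by simp [h])
  rw [show (n : ℂ) + 1 = 1 / x by rw [hnx]; ring,
    show (n : ℂ) + 2 = (1 + x) / x by rw [hnx]; field_simp; ring,
    show a + (n : ℂ) + 1 = (1 + a * x) / x by rw [hnx]; field_simp; ring,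
    show b + (n : ℂ) + 1 = (1 + b * x) / x by rw [hnx]; field_simp; ring,
    show c + (n : ℂ) + 1 = (1 + c * x) / x by rw [hnx]; field_simp; ring]
  field_simp
  unfold ansatzRemainder
  linear_combination -(e0 + x * e1 + x ^ 2 * e2 + x ^ 3 * e3)

theorem gauss_hypergeometric_order_three_solution (a b c z : ℂ) (hz : z ≠ 1)
    (γ0 γ1 γ2 γ3 : ℂ)
    (h0 : γ0 = 1 / (1 - z))
    (h1 : γ1 = z * (a + b - c - 1) / (1 - z) ^ 2)
    (h2 : γ2 = z * ((a ^ 2 + (b - c - 2) * a + b ^ 2 - (c + 2) * b + 1 + 2 * c) * z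
                    + (b - c - 1) * a - (c + 1) * b + 1 + c + c ^ 2) / (1 - z) ^ 3)
    (h3 : γ3 = z * ((a ^ 3 + (b - c - 3) * a ^ 2 + (b ^ 2 - (c + 3) * b + 3 + 3 * c) * a
                      + b ^ 3 - (c + 3) * b ^ 2 + (3 + 3 * c) * b - 1 - 3 * c) * z ^ 2
                    + ((2 * b - 2 * c - 3) * a ^ 2
                        + (2 * b ^ 2 - (4 * c + 8) * b + 2 * c ^ 2 + 7 + 8 * c) * a
                        - (2 * c + 3) * b ^ 2 + (2 * c ^ 2 + 7 + 8 * c) * b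
                        - 4 - 5 * c ^ 2 - 7 * c) * z
                    + (-(c + 1) * b + 1 + c ^ 2 + c) * a + (1 + c ^ 2 + c) * b
                    - 1 - c ^ 2 - c - c ^ 3) / (1 - z) ^ 4) :
    (fun n : ℕ =>
        (γ0 + γ1 / ((n : ℂ) + 1) + γ2 / ((n : ℂ) + 1) ^ 2 + γ3 / ((n : ℂ) + 1) ^ 3)
          - (a + (n : ℂ) + 1) * (b + (n : ℂ) + 1) * z / ((c + (n : ℂ) + 1) * ((n : ℂ) + 2))
              * (γ0 + γ1 / ((n : ℂ) + 2) + γ2 / ((n : ℂ) + 2) ^ 2 + γ3 / ((n : ℂ) + 2) ^ 3)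
          - 1)
      =O[atTop] fun n : ℕ => (n : ℝ) ^ (-4 : ℝ) := by
  have hz' : 1 - z ≠ 0 := sub_ne_zero.mpr hz.symm
  apply ansatz_isBigO <;> subst h0 h1 h2 h3 <;> field_simp <;> ring
end

section
/- For every real number z > 0 and every nonnegative integer n, the truncation error of the asymptotic series for the exponential integral is bounded by the first neglected term: |z e^{z} E₁(z) − ∑_{ν=0}^{n} (−1/z)^{ν} ν!| ≤ (n+1)!/z^{n+1}. In particular, the divergent series ∑_{m=0}^{∞} (−1/z)^{m} m! is asymptotic to z e^{z} E₁(z) in the sense of Poincaré as z → ∞. -/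
open MeasureTheory Finset

/-- The exponential integral `E₁(z) = ∫_z^∞ e^{-t}/t dt` for real `z > 0`. -/
noncomputable def expIntegralE1 (z : ℝ) : ℝ :=
  ∫ t in Set.Ioi z, Real.exp (-t) / t

theorem integrableOn_exp_neg_mul_pow (k : ℕ) :
    IntegrableOn (fun s : ℝ => Real.exp (-s) * s ^ k) (Set.Ioi 0) := by
  have h := Real.GammaIntegral_convergent (s := (k : ℝ) + 1) (by positivity)
  simpa using h

theorem integral_exp_neg_mul_pow (k : ℕ) :
    ∫ s in Set.Ioi (0 : ℝ), Real.exp (-s) * s ^ k = (Nat.factorial k : ℝ) := by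
  rw [← Real.Gamma_nat_eq_factorial, Real.Gamma_eq_integral (by positivity)]
  simp

theorem exp_neg_mul_pow_div_le {z : ℝ} (hz : 0 < z) (k : ℕ) {s : ℝ} (hs : 0 < s) :
    Real.exp (-s) * s ^ k / (1 + s / z) ≤ Real.exp (-s) * s ^ k :=
  div_le_self (by positivity) (by linarith [div_pos hs hz])

theorem integrableOn_exp_neg_mul_pow_div {z : ℝ} (hz : 0 < z) (k : ℕ) :
    IntegrableOn (fun s : ℝ => Real.exp (-s) * s ^ k / (1 + s / z)) (Set.Ioi 0) := by
  refine (integrableOn_exp_neg_mul_pow k).mono' ?_ ?_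
  · exact Measurable.aestronglyMeasurable (by fun_prop)
  · refine (ae_restrict_iff' measurableSet_Ioi).2 (.of_forall fun s (hs : 0 < s) => ?_)
    rw [Real.norm_of_nonneg (by positivity)]
    exact exp_neg_mul_pow_div_le hz k hs

theorem integral_exp_neg_mul_pow_div_nonneg {z : ℝ} (hz : 0 < z) (k : ℕ) :
    0 ≤ ∫ s in Set.Ioi (0 : ℝ), Real.exp (-s) * s ^ k / (1 + s / z) :=
  setIntegral_nonneg measurableSet_Ioi fun s (hs : 0 < s) => by positivity

theorem integral_exp_neg_mul_pow_div_le_factorial {z : ℝ} (hz : 0 < z) (k : ℕ) :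
    ∫ s in Set.Ioi (0 : ℝ), Real.exp (-s) * s ^ k / (1 + s / z) ≤ (Nat.factorial k : ℝ) := by
  rw [← integral_exp_neg_mul_pow]
  exact setIntegral_mono_on (integrableOn_exp_neg_mul_pow_div hz k)
    (integrableOn_exp_neg_mul_pow k) measurableSet_Ioi
    fun s hs => exp_neg_mul_pow_div_le hz k hs

theorem integral_exp_neg_mul_pow_div_eq_factorial_sub {z : ℝ} (hz : 0 < z) (k : ℕ) :
    ∫ s in Set.Ioi (0 : ℝ), Real.exp (-s) * s ^ k / (1 + s / z) =
      (Nat.factorial k : ℝ) -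
        1 / z * ∫ s in Set.Ioi (0 : ℝ), Real.exp (-s) * s ^ (k + 1) / (1 + s / z) := by
  rw [← integral_exp_neg_mul_pow, ← integral_const_mul,
    ← integral_sub (integrableOn_exp_neg_mul_pow k)
      ((integrableOn_exp_neg_mul_pow_div hz (k + 1)).const_mul _)]
  refine setIntegral_congr_fun measurableSet_Ioi fun s (hs : 0 < s) => ?_
  field_simp
  ring

theorem mul_exp_mul_expIntegralE1 {z : ℝ} (hz : 0 < z) :
    z * Real.exp z * expIntegralE1 z =
      ∫ s in Set.Ioi (0 : ℝ), Real.exp (-s) / (1 + s / z) := by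
  have h := (measurePreserving_add_right volume z).setIntegral_preimage_emb
    (measurableEmbedding_addRight z) (fun t : ℝ => Real.exp (-t) / t) (Set.Ioi z)
  rw [Set.preimage_add_const_Ioi, sub_self] at h
  rw [expIntegralE1, ← h, ← integral_const_mul]
  refine setIntegral_congr_fun measurableSet_Ioi fun s (hs : 0 < s) => ?_
  rw [neg_add, Real.exp_add, Real.exp_neg z]
  field_simp
  ring

/-- The exact remainder of the truncated asymptotic series. -/
theorem mul_exp_mul_expIntegralE1_sub_sum {z : ℝ} (hz : 0 < z) (k : ℕ) :
    z * Real.exp z * expIntegralE1 z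
        - ∑ ν ∈ Finset.range k, (-1 / z) ^ ν * (Nat.factorial ν : ℝ) =
      (-1 / z) ^ k * ∫ s in Set.Ioi (0 : ℝ), Real.exp (-s) * s ^ k / (1 + s / z) := by
  induction k with
  | zero => simp [mul_exp_mul_expIntegralE1 hz]
  | succ k ih =>
    rw [Finset.sum_range_succ, ← sub_sub, ih, integral_exp_neg_mul_pow_div_eq_factorial_sub hz k]
    ring

theorem exponential_integral_truncation_error_bound (z : ℝ) (hz : 0 < z) (n : ℕ) :
    |z * Real.exp z * expIntegralE1 z
        - ∑ ν ∈ Finset.range (n + 1), (-1 / z) ^ ν * (Nat.factorial ν : ℝ)|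
      ≤ (Nat.factorial (n + 1) : ℝ) / z ^ (n + 1) := by
  rw [mul_exp_mul_expIntegralE1_sub_sum hz, abs_mul, abs_pow, abs_div, abs_neg, abs_one,
    abs_of_pos hz, abs_of_nonneg (integral_exp_neg_mul_pow_div_nonneg hz _), one_div, inv_pow,
    inv_mul_eq_div]
  gcongr
  exact integral_exp_neg_mul_pow_div_le_factorial hz _
end

section
/- For every real number z > 0, the truncation error of the asymptotic series for the exponential integral is asymptotically equal to the last retained term: lim_{n→∞} [∑_{ν=0}^{n} (−1/z)^{ν} ν! − z e^{z} E₁(z)] / [(−1/z)^{n} n!] = 1. Equivalently, lim_{n→∞} (1/(z·n!)) ∫_0^{∞} t^{n+1} e^{−t}/(1 + t/z) dt = 1. -/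
open MeasureTheory Finset Filter

/-- The integrand `tⁿ e^{-t}` of Euler's integral is integrable on `(0, ∞)`. -/
theorem integrableOn_pow_mul_exp_neg (n : ℕ) :
    IntegrableOn (fun t : ℝ => t ^ n * Real.exp (-t)) (Set.Ioi 0) := by
  refine (Real.GammaIntegral_convergent (s := n + 1) (by positivity)).congr_fun
    (fun t _ => ?_) measurableSet_Ioi
  simp [mul_comm]

/-- Euler's integral for the factorial. -/
theorem integral_pow_mul_exp_neg (n : ℕ) :
    ∫ t in Set.Ioi (0 : ℝ), t ^ n * Real.exp (-t) = (n.factorial : ℝ) := by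
  rw [← Real.Gamma_nat_eq_factorial, Real.Gamma_eq_integral (by positivity)]
  refine setIntegral_congr_fun measurableSet_Ioi fun t _ => ?_
  simp [mul_comm]

/-- The Stieltjes-type moment `∫₀^∞ tⁿ e^{-t} / (1 + t / z) dt`. -/
noncomputable def expIntegralMoment (z : ℝ) (n : ℕ) : ℝ :=
  ∫ t in Set.Ioi (0 : ℝ), t ^ n * Real.exp (-t) / (1 + t / z)

theorem expIntegralMoment_nonneg {z : ℝ} (hz : 0 < z) (n : ℕ) : 0 ≤ expIntegralMoment z n := by
  refine setIntegral_nonneg measurableSet_Ioi fun t (ht : 0 < t) => ?_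
  positivity

theorem integrableOn_expIntegralMoment {z : ℝ} (hz : 0 < z) (n : ℕ) :
    IntegrableOn (fun t : ℝ => t ^ n * Real.exp (-t) / (1 + t / z)) (Set.Ioi 0) := by
  refine (integrableOn_pow_mul_exp_neg n).mono'
    (Measurable.aestronglyMeasurable (by fun_prop)) ?_
  filter_upwards [ae_restrict_mem measurableSet_Ioi] with t (ht : 0 < t)
  rw [Real.norm_of_nonneg (by positivity)]
  exact div_le_self (by positivity) (le_add_of_nonneg_right (by positivity))

theorem expIntegralMoment_succ {z : ℝ} (hz : 0 < z) (n : ℕ) :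
    expIntegralMoment z (n + 1) = z * (n.factorial - expIntegralMoment z n) := by
  rw [← integral_pow_mul_exp_neg, expIntegralMoment, expIntegralMoment,
    ← integral_sub (integrableOn_pow_mul_exp_neg n) (integrableOn_expIntegralMoment hz n),
    ← integral_const_mul]
  refine setIntegral_congr_fun measurableSet_Ioi fun t (ht : 0 < t) => ?_
  have : z + t ≠ 0 := by positivity
  field_simp
  ring

theorem expIntegralMoment_zero {z : ℝ} (hz : 0 < z) :
    expIntegralMoment z 0 = z * Real.exp z * expIntegralE1 z := by
  have shift := (measurePreserving_add_right (volume : Measure ℝ) z).setIntegral_preimage_emb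
    (measurableEmbedding_addRight z) (fun t => Real.exp (-t) / t) (Set.Ioi z)
  rw [Set.preimage_add_const_Ioi, sub_self] at shift
  rw [expIntegralMoment, expIntegralE1, ← shift, ← integral_const_mul]
  refine setIntegral_congr_fun measurableSet_Ioi fun t (ht : 0 < t) => ?_
  have : z + t ≠ 0 := by positivity
  have : t + z ≠ 0 := by positivity
  simp only [neg_add, Real.exp_add, Real.exp_neg]
  field_simp
  ring

/-- The truncation error of the asymptotic series, relative to the last retained term. -/
theorem truncation_error_eq_expIntegralMoment {z : ℝ} (hz : 0 < z) (n : ℕ) :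
    ∑ ν ∈ Finset.range (n + 1), (-1 / z) ^ ν * (ν.factorial : ℝ)
        - z * Real.exp z * expIntegralE1 z
      = (-1 / z) ^ n * (expIntegralMoment z (n + 1) / z) := by
  induction n with
  | zero =>
    rw [expIntegralMoment_succ hz, expIntegralMoment_zero hz]
    field_simp
    simp
  | succ n ih =>
    rw [Finset.sum_range_succ, add_sub_right_comm, ih, expIntegralMoment_succ hz (n + 1), pow_succ]
    field_simp
    ring

theorem tendsto_expIntegralMoment_div_factorial {z : ℝ} (hz : 0 < z) :
    Tendsto (fun n : ℕ => expIntegralMoment z n / n.factorial) atTop (nhds 0) := by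
  rw [← tendsto_add_atTop_iff_nat 1]
  have lim : Tendsto (fun n : ℕ => z * (1 / ((n : ℝ) + 1))) atTop (nhds 0) := by
    simpa using tendsto_one_div_add_atTop_nhds_zero_nat.const_mul z
  refine squeeze_zero (fun n => div_nonneg (expIntegralMoment_nonneg hz _) (by positivity))
    (fun n => ?_) lim
  rw [expIntegralMoment_succ hz, Nat.factorial_succ, div_le_iff₀ (by positivity)]
  push_cast
  field_simp
  linarith [expIntegralMoment_nonneg hz n]

theorem tendsto_expIntegralMoment_succ_div {z : ℝ} (hz : 0 < z) :
    Tendsto (fun n : ℕ => 1 / (z * (n.factorial : ℝ)) * expIntegralMoment z (n + 1))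
      atTop (nhds 1) := by
  have lim := (tendsto_expIntegralMoment_div_factorial hz).const_sub 1
  rw [sub_zero] at lim
  refine lim.congr fun n => ?_
  rw [expIntegralMoment_succ hz]
  field_simp

theorem exponential_integral_truncation_error_asymptotics (z : ℝ) (hz : 0 < z) :
    Tendsto
      (fun n : ℕ =>
        (∑ ν ∈ Finset.range (n + 1), (-1 / z) ^ ν * (Nat.factorial ν : ℝ)
            - z * Real.exp z * expIntegralE1 z)
          / ((-1 / z) ^ n * (Nat.factorial n : ℝ)))
      atTop (nhds 1) ∧
    Tendsto
      (fun n : ℕ =>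
        (1 / (z * (Nat.factorial n : ℝ)))
          * ∫ t in Set.Ioi (0 : ℝ), t ^ (n + 1) * Real.exp (-t) / (1 + t / z))
      atTop (nhds 1) := by
  refine ⟨(tendsto_expIntegralMoment_succ_div hz).congr fun n => ?_,
    tendsto_expIntegralMoment_succ_div hz⟩
  have hpow : (-1 / z) ^ n ≠ 0 := pow_ne_zero _ (div_ne_zero (by norm_num) hz.ne')
  rw [truncation_error_eq_expIntegralMoment hz, mul_div_mul_left _ _ hpow]
  field_simp
end

section
/- Let z be a complex number and set γ_0 = −1, γ_1 = z, γ_2 = −(z−1)z, γ_3 = (z² − 3z + 1)z, and γ_4 = −(z³ − 6z² + 7z − 1)z. Then, as n → ∞, (−z/(n+1)) ∑_{μ=0}^{4} γ_μ/(n+1)^μ − ∑_{μ=0}^{4} γ_μ/(n+2)^μ − 1 = O(n^{−5}). -/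
open Filter Asymptotics

/-- The coefficient of `(x + 1)⁻⁵` in the order-four defect, as a polynomial in `v = (x + 2)⁻¹`. -/
def defectCofactor (z v : ℂ) : ℂ :=
  z ^ 2 * (z ^ 3 - 6 * z ^ 2 + 7 * z - 1) - z * (1 - v)
    - (z - 1) * z * ((4 - v) * (1 - v))
    - (z ^ 2 - 3 * z + 1) * z * (6 * (1 - v) ^ 3 + 8 * v * (1 - v) ^ 2 + 3 * v ^ 2 * (1 - v))
    - (z ^ 3 - 6 * z ^ 2 + 7 * z - 1) * z
      * (4 * (1 - v) ^ 4 + 6 * v * (1 - v) ^ 3 + 4 * v ^ 2 * (1 - v) ^ 2 + v ^ 3 * (1 - v))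

lemma defect_eq_inv_pow_mul_cofactor (z x : ℂ) (hx1 : x + 1 ≠ 0) (hx2 : x + 2 ≠ 0) :
    (-z / (x + 1))
        * (-1 + z / (x + 1) + -(z - 1) * z / (x + 1) ^ 2
            + (z ^ 2 - 3 * z + 1) * z / (x + 1) ^ 3
            + -(z ^ 3 - 6 * z ^ 2 + 7 * z - 1) * z / (x + 1) ^ 4)
      - (-1 + z / (x + 2) + -(z - 1) * z / (x + 2) ^ 2
            + (z ^ 2 - 3 * z + 1) * z / (x + 2) ^ 3
            + -(z ^ 3 - 6 * z ^ 2 + 7 * z - 1) * z / (x + 2) ^ 4)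
      - 1
      = ((x + 1) ^ 5)⁻¹ * defectCofactor z (x + 2)⁻¹ := by
  unfold defectCofactor
  field_simp
  ring

lemma isBigO_inv_natCast_add_one_pow_five :
    (fun n : ℕ => (((n : ℂ) + 1) ^ 5)⁻¹) =O[atTop] fun n : ℕ => (n : ℝ) ^ (-5 : ℝ) := by
  refine IsBigO.of_bound 1 ?_
  filter_upwards [eventually_gt_atTop 0] with n hn
  have hn' : (0 : ℝ) < n := by exact_mod_cast hn
  have hnorm : ‖(n : ℂ) + 1‖ = n + 1 := by exact_mod_cast Complex.norm_natCast (n + 1)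
  have hrpow : (n : ℝ) ^ (-5 : ℝ) = ((n : ℝ) ^ 5)⁻¹ := by
    rw [Real.rpow_neg hn'.le]
    norm_cast
  rw [norm_inv, norm_pow, hnorm, hrpow, one_mul, Real.norm_of_nonneg (by positivity)]
  gcongr
  linarith

lemma tendsto_inv_natCast_add_two :
    Tendsto (fun n : ℕ => ((n : ℂ) + 2)⁻¹) atTop (nhds 0) := by
  have h := (tendsto_inv_atTop_nhds_zero_nat (𝕜 := ℂ)).comp (tendsto_add_atTop_nat 2)
  simpa [Function.comp_def] using h

theorem exponential_integral_order_four_solution (z : ℂ) (γ0 γ1 γ2 γ3 γ4 : ℂ)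
    (h0 : γ0 = -1) (h1 : γ1 = z) (h2 : γ2 = -(z - 1) * z)
    (h3 : γ3 = (z ^ 2 - 3 * z + 1) * z) (h4 : γ4 = -(z ^ 3 - 6 * z ^ 2 + 7 * z - 1) * z) :
    (fun n : ℕ =>
        (-z / ((n : ℂ) + 1))
            * (γ0 + γ1 / ((n : ℂ) + 1) + γ2 / ((n : ℂ) + 1) ^ 2 + γ3 / ((n : ℂ) + 1) ^ 3
                + γ4 / ((n : ℂ) + 1) ^ 4)
          - (γ0 + γ1 / ((n : ℂ) + 2) + γ2 / ((n : ℂ) + 2) ^ 2 + γ3 / ((n : ℂ) + 2) ^ 3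
                + γ4 / ((n : ℂ) + 2) ^ 4)
          - 1)
      =O[atTop] fun n : ℕ => (n : ℝ) ^ (-5 : ℝ) := by
  subst h0 h1 h2 h3 h4
  have hcont : Continuous (defectCofactor γ1) := by
    unfold defectCofactor
    fun_prop
  have hbdd : (fun n : ℕ => defectCofactor γ1 ((n : ℂ) + 2)⁻¹) =O[atTop] fun _ => (1 : ℝ) :=
    ((hcont.tendsto 0).comp tendsto_inv_natCast_add_two).isBigO_one ℝ
  have hmul := isBigO_inv_natCast_add_one_pow_five.mul hbdd
  simp only [mul_one] at hmul
  refine hmul.congr_left fun n => (defect_eq_inv_pow_mul_cofactor γ1 n ?_ ?_).symm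
  · exact_mod_cast n.succ_ne_zero
  · exact_mod_cast (n + 1).succ_ne_zero
end

section
/- For every nonnegative integer k and every real number x > 0, the inverse power 1/x^{k+1} has the convergent factorial series expansion 1/x^{k+1} = ∑_{κ=0}^{∞} c(k+κ, k) / (x)_{k+κ+1}, where c(n, k) denotes the unsigned Stirling number of the first kind, i.e., the coefficient of X^k in the polynomial X(X+1)⋯(X+n−1), and (x)_m = x(x+1)⋯(x+m−1) is the Pochhammer symbol. Equivalently, in terms of the signed Stirling numbers S⁽¹⁾(n, k) = (−1)^{n−k} c(n, k) defined by (z−n+1)_n = ∑_{ν=0}^{n} S⁽¹⁾(n, ν) z^{ν}, one has 1/x^{k+1} = ∑_{κ=0}^{∞} (−1)^{κ} S⁽¹⁾(k+κ, k)/(x)_{k+κ+1}. -/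
open Polynomial

/-- The unsigned Stirling number of the first kind `c(n, k)`: the coefficient of `X^k`
in the polynomial `X(X+1)⋯(X+n-1)`. -/
noncomputable def stirlingFirstUnsigned (n k : ℕ) : ℕ :=
  (ascPochhammer ℕ n).coeff k

/-- The signed Stirling number of the first kind `S⁽¹⁾(n, k) = (-1)^(n-k) c(n, k)`. -/
noncomputable def stirlingFirstSigned (n k : ℕ) : ℤ :=
  (-1) ^ (n - k) * (stirlingFirstUnsigned n k : ℤ)

open Filter Topology

theorem stirlingFirstUnsigned_succ_zero (n : ℕ) : stirlingFirstUnsigned (n + 1) 0 = 0 := by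
  simp [stirlingFirstUnsigned, ascPochhammer_succ_left]

theorem stirlingFirstUnsigned_succ_succ (n k : ℕ) :
    stirlingFirstUnsigned (n + 1) (k + 1) =
      stirlingFirstUnsigned n k + n * stirlingFirstUnsigned n (k + 1) := by
  rw [stirlingFirstUnsigned, ascPochhammer_succ_right, mul_add, coeff_add, coeff_mul_X,
    ← C_eq_natCast, coeff_mul_C, mul_comm]
  simp [stirlingFirstUnsigned]

theorem stirlingFirstUnsigned_eq_zero_of_lt {n k : ℕ} (h : n < k) :
    stirlingFirstUnsigned n k = 0 :=
  coeff_eq_zero_of_natDegree_lt (by rwa [ascPochhammer_natDegree])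

/-- A convergent nonnegative sequence whose quotients by `x + n` are summable tends to zero. -/
theorem eq_zero_of_tendsto_of_summable_div_add {a : ℕ → ℝ} {L x : ℝ} (hx : 0 < x)
    (ha : Tendsto a atTop (𝓝 L)) (ha0 : ∀ n, 0 ≤ a n)
    (hs : Summable fun n : ℕ => a n / (x + n)) : L = 0 := by
  by_contra hL
  have hLpos : 0 < L := lt_of_le_of_ne (ge_of_tendsto' ha ha0) (Ne.symm hL)
  refine Real.not_summable_one_div_natCast (summable_of_isBigO_nat hs ?_)
  refine Asymptotics.IsBigO.of_bound (2 * (x + 1) / L) ?_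
  filter_upwards [ha.eventually (lt_mem_nhds (half_lt_self hLpos)), eventually_ge_atTop 1]
    with n hn h1
  have hn1 : (1 : ℝ) ≤ n := by exact_mod_cast h1
  have hpos : 0 < x + n := by positivity
  rw [Real.norm_of_nonneg (by positivity), Real.norm_of_nonneg (div_nonneg (ha0 n) hpos.le),
    div_mul_div_comm, div_le_div_iff₀ (by positivity) (by positivity)]
  calc 1 * (L * (x + n)) ≤ L * ((x + 1) * n) := by
        rw [one_mul]
        gcongr
        nlinarith
    _ = 2 * (x + 1) * (L / 2) * n := by ring
    _ ≤ 2 * (x + 1) * a n * n := by gcongr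

/-- The telescoping identity behind the factorial series of inverse powers. -/
theorem sum_range_stirlingFirstUnsigned_div_sub (k N : ℕ) {x : ℝ} (hx : 0 < x) :
    ∑ n ∈ Finset.range N,
        (stirlingFirstUnsigned n k : ℝ) / (ascPochhammer ℝ (n + 1)).eval x -
      x * ∑ n ∈ Finset.range N,
        (stirlingFirstUnsigned n (k + 1) : ℝ) / (ascPochhammer ℝ (n + 1)).eval x =
      (stirlingFirstUnsigned N (k + 1) : ℝ) / (ascPochhammer ℝ N).eval x := by
  induction N with
  | zero => simp [stirlingFirstUnsigned_eq_zero_of_lt]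
  | succ N ih =>
    have hP : (ascPochhammer ℝ N).eval x ≠ 0 := (ascPochhammer_pos N x hx).ne'
    have hxN : x + N ≠ 0 := by positivity
    have hstep : (stirlingFirstUnsigned (N + 1) (k + 1) : ℝ) / (ascPochhammer ℝ (N + 1)).eval x =
        (stirlingFirstUnsigned N (k + 1) : ℝ) / (ascPochhammer ℝ N).eval x +
        ((stirlingFirstUnsigned N k : ℝ) / (ascPochhammer ℝ (N + 1)).eval x -
          x * ((stirlingFirstUnsigned N (k + 1) : ℝ) / (ascPochhammer ℝ (N + 1)).eval x)) := by
      rw [stirlingFirstUnsigned_succ_succ, ascPochhammer_succ_eval]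
      push_cast
      field_simp
      ring
    rw [Finset.sum_range_succ, Finset.sum_range_succ, hstep, ← ih]
    ring

theorem hasSum_stirlingFirstUnsigned_div (k : ℕ) {x : ℝ} (hx : 0 < x) :
    HasSum (fun n : ℕ => (stirlingFirstUnsigned n k : ℝ) / (ascPochhammer ℝ (n + 1)).eval x)
      (1 / x ^ (k + 1)) := by
  have hnonneg (j m n : ℕ) :
      0 ≤ (stirlingFirstUnsigned n j : ℝ) / (ascPochhammer ℝ m).eval x :=
    div_nonneg (Nat.cast_nonneg _) (ascPochhammer_pos m x hx).le
  induction k with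
  | zero =>
    convert hasSum_single (f := fun n : ℕ =>
      (stirlingFirstUnsigned n 0 : ℝ) / (ascPochhammer ℝ (n + 1)).eval x) 0 ?_ using 1
    · simp [stirlingFirstUnsigned]
    · intro n hn
      obtain ⟨m, rfl⟩ := Nat.exists_eq_succ_of_ne_zero hn
      simp [stirlingFirstUnsigned_succ_zero]
  | succ k ih =>
    have hs : Summable fun n : ℕ =>
        (stirlingFirstUnsigned n (k + 1) : ℝ) / (ascPochhammer ℝ (n + 1)).eval x := by
      refine summable_of_sum_range_le (c := 1 / x ^ (k + 1) / x) (fun n => hnonneg _ _ n) ?_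
      intro N
      rw [le_div_iff₀' hx]
      have h1 := sum_range_stirlingFirstUnsigned_div_sub k N hx
      have h2 := sum_le_hasSum (Finset.range N) (fun n _ => hnonneg k (n + 1) n) ih
      linarith [hnonneg (k + 1) N N]
    have hlim : Tendsto
        (fun N => (stirlingFirstUnsigned N (k + 1) : ℝ) / (ascPochhammer ℝ N).eval x) atTop
        (𝓝 (1 / x ^ (k + 1) - x * ∑' n : ℕ,
          (stirlingFirstUnsigned n (k + 1) : ℝ) / (ascPochhammer ℝ (n + 1)).eval x)) :=
      (ih.tendsto_sum_nat.sub (hs.hasSum.tendsto_sum_nat.const_mul x)).congr fun N =>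
        sum_range_stirlingFirstUnsigned_div_sub k N hx
    have hzero := eq_zero_of_tendsto_of_summable_div_add hx hlim (fun n => hnonneg _ n n)
      (hs.congr fun n => by rw [ascPochhammer_succ_eval, div_div])
    convert hs.hasSum using 1
    rw [pow_succ, ← div_div, div_eq_iff hx.ne']
    linarith

theorem inverse_power_factorial_series (k : ℕ) (x : ℝ) (hx : 0 < x) :
    HasSum
      (fun κ : ℕ =>
        (stirlingFirstUnsigned (k + κ) k : ℝ) / (ascPochhammer ℝ (k + κ + 1)).eval x)
      (1 / x ^ (k + 1)) ∧
    HasSum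
      (fun κ : ℕ =>
        (-1 : ℝ) ^ κ * (stirlingFirstSigned (k + κ) k : ℝ)
          / (ascPochhammer ℝ (k + κ + 1)).eval x)
      (1 / x ^ (k + 1)) := by
  have h : HasSum
      (fun κ : ℕ =>
        (stirlingFirstUnsigned (k + κ) k : ℝ) / (ascPochhammer ℝ (k + κ + 1)).eval x)
      (1 / x ^ (k + 1)) := by
    refine ((add_right_injective k).hasSum_iff ?_).mpr (hasSum_stirlingFirstUnsigned_div k hx)
    intro n hn
    have hnk : n < k := by
      by_contra! hkn
      exact hn ⟨n - k, Nat.add_sub_cancel' hkn⟩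
    simp [stirlingFirstUnsigned_eq_zero_of_lt hnk]
  refine ⟨h, h.congr_fun ?_⟩
  intro κ
  simp [stirlingFirstSigned, ← mul_assoc, ← mul_pow]
end
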